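/- Spectrum of random outer products (existence): for every n ∈ ℕ there exist constants c₀ ∈ ℕ, c₁, c₂ ∈ (0,1) (independent of n) and vectors u_1,…,u_{m₀} ∈ {0,1}^n with m₀ = 2^{c₀}·n such that for every subset J ⊆ [m₀] with |J| ≥ (1−c₁)·m₀, λ_min((1/|J|)·∑_{j∈J} u_j u_jᵀ) ≥ c₂. -/

import Mathlib

open Matrix Finset

/-- The sign attached to a boolean. -/
noncomputable def sgnB (b : Bool) : ℝ := if b then 1 else -1

/-- Signed sum. -/
noncomputable def sdot {n : ℕ} (a : Fin n → Bool) (y : Fin n → ℝ) : ℝ := ∑ i, sgnB (a i) * y i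

lemma sum_prod_bool {R : Type*} [CommSemiring R] {n : ℕ} (F : Fin n → Bool → R) :
    ∑ a : Fin n → Bool, ∏ i, F i (a i) = ∏ i, (F i true + F i false) := by
  have := Finset.prod_univ_sum (fun _ : Fin n => (Finset.univ : Finset Bool)) F
  simp only [Fintype.sum_bool, Fintype.piFinset_univ] at this
  exact this.symm

lemma sum_exp_sdot {n : ℕ} (s : ℝ) (y : Fin n → ℝ) :
    ∑ a : Fin n → Bool, Real.exp (s * sdot a y) = 2 ^ n * ∏ i, Real.cosh (s * y i) := by
  have h := sum_prod_bool (fun (i : Fin n) b => Real.exp (s * (sgnB b * y i)))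
  have h2 : ∀ a : Fin n → Bool, Real.exp (s * sdot a y)
      = ∏ i, Real.exp (s * (sgnB (a i) * y i)) := by
    intro a
    rw [← Real.exp_sum, sdot, Finset.mul_sum]
  simp_rw [h2]
  rw [h]
  have : ∀ i, Real.exp (s * (sgnB true * y i)) + Real.exp (s * (sgnB false * y i))
      = 2 * Real.cosh (s * y i) := by
    intro i
    rw [Real.cosh_eq]; simp [sgnB]; ring
  simp_rw [this, Finset.prod_mul_distrib]
  simp

lemma sum_cos_sdot {n : ℕ} (y : Fin n → ℝ) :
    ∑ a : Fin n → Bool, Real.cos (sdot a y) = 2 ^ n * ∏ i, Real.cos (y i) := by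
  have h := sum_prod_bool (fun (i : Fin n) b => Complex.exp ((sgnB b * y i : ℝ) * Complex.I))
  have h2 : ∀ a : Fin n → Bool, Complex.exp ((sdot a y : ℝ) * Complex.I)
      = ∏ i, Complex.exp ((sgnB (a i) * y i : ℝ) * Complex.I) := by
    intro a
    rw [← Complex.exp_sum, sdot, ← Finset.sum_mul]
    push_cast; rfl
  have h3 : ∀ i, Complex.exp ((sgnB true * y i : ℝ) * Complex.I)
      + Complex.exp ((sgnB false * y i : ℝ) * Complex.I) = ((2 * Real.cos (y i) : ℝ) : ℂ) := by
    intro i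
    push_cast
    rw [Complex.cos]; simp [sgnB]; ring
  simp_rw [← h2, h3, ← Complex.ofReal_prod] at h
  have h4 := congrArg Complex.re h
  rw [Complex.re_sum, Complex.ofReal_re] at h4
  simp_rw [Complex.exp_ofReal_mul_I_re] at h4
  rw [h4, Finset.prod_mul_distrib]; simp

lemma abs_cos_le_exp {x : ℝ} (hx : |x| ≤ 3/2) : |Real.cos x| ≤ Real.exp (-(x^2/5)) := by
  have hpi := Real.pi_gt_three
  have hpi2 := Real.pi_lt_d2
  have h0 : 0 ≤ Real.cos x := Real.cos_nonneg_of_mem_Icc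
    ⟨by linarith [neg_abs_le x], by linarith [le_abs_self x]⟩
  rw [abs_of_nonneg h0]
  have h2 : Real.cos x ≤ 1 - 2 / Real.pi ^ 2 * x ^ 2 :=
    Real.cos_le_one_sub_mul_cos_sq (by linarith)
  have h3 : 1/5 ≤ 2 / Real.pi ^ 2 := by
    rw [div_le_div_iff₀ (by norm_num) (by positivity)]; nlinarith
  have h4 := Real.add_one_le_exp (-(x^2/5))
  nlinarith [sq_nonneg x]

lemma sum_exp_g {n : ℕ} (y : Fin n → ℝ) (hy : ∑ i, y i ^ 2 ≤ 9/4) (hy' : 1/2 ≤ ∑ i, y i ^ 2) :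
    ∑ a : Fin n → Bool, Real.exp (-(1 - Real.cos (sdot a y))) ≤ 2 ^ n * Real.exp (-(1/33)) := by
  have hp : ∏ i, Real.cos (y i) ≤ 10/11 := by
    calc ∏ i, Real.cos (y i) ≤ |∏ i, Real.cos (y i)| := le_abs_self _
      _ = ∏ i, |Real.cos (y i)| := Finset.abs_prod _ _
      _ ≤ ∏ i, Real.exp (-(y i ^ 2/5)) := by
        apply Finset.prod_le_prod
        · intros; positivity
        · intro i _
          apply abs_cos_le_exp
          refine abs_le_of_sq_le_sq (b := (3/2 : ℝ)) ?_ (by norm_num)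
          have := Finset.single_le_sum (f := fun i => y i ^ 2) (fun i _ => sq_nonneg (y i)) (Finset.mem_univ i)
          linarith
      _ = Real.exp (-((∑ i, y i ^ 2)/5)) := by
        rw [← Real.exp_sum, Finset.sum_neg_distrib, Finset.sum_div]
      _ ≤ Real.exp (-(1/10)) := by
        apply Real.exp_le_exp.mpr; linarith
      _ ≤ 10/11 := by
        rw [Real.exp_neg]
        have := Real.add_one_le_exp (1/10 : ℝ)
        rw [inv_le_comm₀ (Real.exp_pos _) (by norm_num)]
        linarith
  have hpt : ∀ t : ℝ, Real.exp (-(1 - Real.cos t)) ≤ 1 - (1 - Real.cos t)/3 := by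
    intro t
    have h1 := Real.cos_le_one t
    have h2 := Real.neg_one_le_cos t
    rw [Real.exp_neg]
    have := Real.add_one_le_exp (1 - Real.cos t)
    have h5 : 0 < 1 - (1 - Real.cos t)/3 := by linarith
    rw [inv_le_comm₀ (Real.exp_pos _) h5]
    refine le_trans ?_ this
    rw [inv_le_comm₀ h5 (by linarith), inv_le_iff_one_le_mul₀ (by linarith)]
    nlinarith
  calc _ ≤ ∑ a : Fin n → Bool, (1 - (1 - Real.cos (sdot a y))/3) :=
        Finset.sum_le_sum fun a _ => hpt _
    _ = 2 ^ n * (2/3 + (∏ i, Real.cos (y i))/3) := by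
        have : ∀ a : Fin n → Bool, (1 - (1 - Real.cos (sdot a y))/3) = 2/3 + Real.cos (sdot a y) / 3 := by
          intro a; ring
        simp_rw [this, Finset.sum_add_distrib, ← Finset.sum_div, sum_cos_sdot]
        simp; ring
    _ ≤ _ := by
        have := Real.add_one_le_exp (-(1/33) : ℝ)
        gcongr; linarith

lemma bad1 {M n : ℕ} (y : Fin n → ℝ) (hy : ∑ i, y i ^ 2 ≤ 9/4) (hy' : 1/2 ≤ ∑ i, y i ^ 2) :
    (((Finset.univ : Finset (Fin M → Fin n → Bool)).filter
      (fun w => ∑ j, (1 - Real.cos (sdot (w j) y)) ≤ M/66)).card : ℝ)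
      ≤ (2^n)^M * Real.exp (-(M/66)) := by
  have h1 : (((Finset.univ : Finset (Fin M → Fin n → Bool)).filter
      (fun w => ∑ j, (1 - Real.cos (sdot (w j) y)) ≤ M/66)).card : ℝ)
      ≤ ∑ w : Fin M → Fin n → Bool, Real.exp (M/66) * ∏ j, Real.exp (-(1 - Real.cos (sdot (w j) y))) := by
    rw [Finset.card_eq_sum_ones]; push_cast
    rw [Finset.sum_filter]
    apply Finset.sum_le_sum
    intro w _
    rw [← Real.exp_sum, ← Real.exp_add, Finset.sum_neg_distrib]
    split_ifs with h
    · exact Real.one_le_exp (by linarith)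
    · positivity
  refine h1.trans ?_
  rw [← Finset.mul_sum, ← Fintype.sum_pow (fun a : Fin n → Bool => Real.exp (-(1 - Real.cos (sdot a y)))) M]
  calc _ ≤ Real.exp (M/66) * (2 ^ n * Real.exp (-(1/33)))^M := by
        gcongr; exact sum_exp_g y hy hy'
    _ = _ := by
        rw [mul_pow, ← Real.exp_nat_mul, mul_left_comm, ← Real.exp_add]
        congr 2; ring

lemma bad2 {M n : ℕ} (s : Fin M → Bool) (y : Fin n → ℝ) (hy : ∑ i, y i ^ 2 ≤ 9/4) :
    (((Finset.univ : Finset (Fin M → Fin n → Bool)).filter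
      (fun w => 4 * (M:ℝ) ≤ ∑ j, sgnB (s j) * sdot (w j) y)).card : ℝ)
      ≤ (2^n)^M * Real.exp (-(2*M)) := by
  have h1 : (((Finset.univ : Finset (Fin M → Fin n → Bool)).filter
      (fun w => 4 * (M:ℝ) ≤ ∑ j, sgnB (s j) * sdot (w j) y)).card : ℝ)
      ≤ ∑ w : Fin M → Fin n → Bool, Real.exp (-(4*M)) * ∏ j, Real.exp (sgnB (s j) * sdot (w j) y) := by
    rw [Finset.card_eq_sum_ones]; push_cast
    rw [Finset.sum_filter]
    apply Finset.sum_le_sum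
    intro w _
    rw [← Real.exp_sum, ← Real.exp_add]
    split_ifs with h
    · exact Real.one_le_exp (by linarith)
    · positivity
  refine h1.trans ?_
  have h2 := Finset.prod_univ_sum (fun _ : Fin M => (Finset.univ : Finset (Fin n → Bool)))
    (fun j a => Real.exp (sgnB (s j) * sdot a y))
  rw [Fintype.piFinset_univ] at h2
  rw [← Finset.mul_sum, ← h2]
  have h3 : ∀ j, ∑ a : Fin n → Bool, Real.exp (sgnB (s j) * sdot a y) ≤ 2^n * Real.exp 2 := by
    intro j
    rw [sum_exp_sdot]
    gcongr
    calc ∏ i, Real.cosh (sgnB (s j) * y i) ≤ ∏ i, Real.exp (y i ^ 2 / 2) := by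
          apply Finset.prod_le_prod
          · intros; positivity
          · intro i _
            refine (Real.cosh_le_exp_half_sq _).trans (le_of_eq ?_)
            congr 2
            cases s j <;> simp [sgnB]
      _ = Real.exp ((∑ i, y i ^ 2)/2) := by rw [← Real.exp_sum, Finset.sum_div]
      _ ≤ _ := by apply Real.exp_le_exp.mpr; linarith
  calc _ ≤ Real.exp (-(4*M)) * ∏ j : Fin M, (2 ^ n * Real.exp 2) := by
        gcongr with j
        exact h3 j
    _ = _ := by
        rw [Finset.prod_const, Finset.card_univ, Fintype.card_fin, mul_pow, ← Real.exp_nat_mul, mul_left_comm, ← Real.exp_add]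
        congr 2; ring

/-- Integer points of small norm. -/
noncomputable def netZ (n B : ℕ) : Finset (Fin n → ℤ) :=
  (Fintype.piFinset (fun _ : Fin n => Finset.Icc (-(B * n : ℤ)) (B * n))).filter
    (fun z => ∑ i, z i ^ 2 ≤ B * n)

lemma mem_netZ {n B : ℕ} (z : Fin n → ℤ) : z ∈ netZ n B ↔ ∑ i, z i ^ 2 ≤ B * n := by
  unfold netZ
  rw [Finset.mem_filter, Fintype.mem_piFinset]
  refine ⟨fun h => h.2, fun h => ⟨fun i => ?_, h⟩⟩
  have := Finset.single_le_sum (f := fun i => z i ^ 2) (fun i _ => sq_nonneg (z i)) (Finset.mem_univ i)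
  have h1 : |z i| ≤ z i ^ 2 := by rw [← sq_abs]; exact Int.le_self_sq _
  rw [Finset.mem_Icc]
  exact abs_le.mp (by linarith)

lemma sum_exp_abs (L : ℕ) : ∑ k ∈ Finset.Icc (-(L:ℤ)) L, Real.exp (-(|(k:ℝ)|)) ≤ 4 - 2 * Real.exp (-L) := by
  induction L with
  | zero => simp; norm_num
  | succ L ih =>
    have : Finset.Icc (-((L+1 : ℕ):ℤ)) ((L+1 : ℕ):ℤ)
        = insert (-((L:ℤ)+1)) (insert ((L:ℤ)+1) (Finset.Icc (-(L:ℤ)) L)) := by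
      ext k; simp; omega
    rw [this, Finset.sum_insert (by simp; omega), Finset.sum_insert (by simp)]
    have e1 : |(((-((L:ℤ)+1) : ℤ)) : ℝ)| = L + 1 := by
      push_cast; rw [abs_neg, abs_of_nonneg (by positivity)]
    have e2 : |((((L:ℤ)+1 : ℤ)) : ℝ)| = L + 1 := by
      push_cast; rw [abs_of_nonneg (by positivity)]
    rw [e1, e2]
    have h5 : Real.exp (-(L:ℝ)) = Real.exp (-((L:ℝ)+1)) * Real.exp 1 := by
      rw [← Real.exp_add]; congr 1; ring
    have h6 := Real.exp_one_gt_d9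
    have h7 := Real.exp_pos (-((L:ℝ)+1))
    push_cast
    nlinarith

lemma card_netZ (n B : ℕ) : ((netZ n B).card : ℝ) ≤ Real.exp ((B + 2) * n) := by
  have h1 : ((netZ n B).card : ℝ) ≤
      ∑ z ∈ Fintype.piFinset (fun _ : Fin n => Finset.Icc (-(B * n : ℤ)) (B * n)),
        Real.exp (B * n) * ∏ i, Real.exp (-|(z i : ℝ)|) := by
    rw [Finset.card_eq_sum_ones]; push_cast
    rw [netZ, Finset.sum_filter]
    apply Finset.sum_le_sum
    intro z _
    rw [← Real.exp_sum, ← Real.exp_add, Finset.sum_neg_distrib]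
    split_ifs with h
    · apply Real.one_le_exp
      have h2 : ∑ i, |(z i : ℝ)| ≤ ∑ i, (z i : ℝ)^2 := by
        apply Finset.sum_le_sum
        intro i _
        have h1 : |z i| ≤ z i ^ 2 := by rw [← sq_abs]; exact Int.le_self_sq _
        exact_mod_cast h1
      have h3 : ∑ i, (z i : ℝ)^2 ≤ B * n := by exact_mod_cast h
      linarith
    · positivity
  refine h1.trans ?_
  rw [← Finset.mul_sum, ← Finset.prod_univ_sum (fun _ : Fin n => Finset.Icc (-(B * n : ℤ)) (B * n))
    (fun _ k => Real.exp (-|(k:ℝ)|)), Finset.prod_const, Finset.card_univ, Fintype.card_fin]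
  have h2 : ∑ k ∈ Finset.Icc (-(B * n : ℤ)) (B * n), Real.exp (-|(k:ℝ)|) ≤ Real.exp 2 := by
    have := sum_exp_abs (B * n)
    push_cast at this
    have h7 := Real.exp_pos (-((B:ℝ) * n))
    have h8 : Real.exp 2 = Real.exp 1 * Real.exp 1 := by rw [← Real.exp_add]; norm_num
    have h6 := Real.exp_one_gt_d9
    nlinarith
  calc _ ≤ Real.exp (B * n) * (Real.exp 2)^n := by
        gcongr
    _ = _ := by
        rw [← Real.exp_nat_mul, ← Real.exp_add]; congr 1; ring

lemma exists_good {n B M : ℕ} (h : ℝ) (hM : ((B:ℝ) + 2) * n + 1 ≤ M / 66) :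
    ∃ w : Fin M → Fin n → Bool, ∀ z ∈ netZ n B,
      ∑ i, (h * (z i : ℝ)) ^ 2 ≤ 9/4 → 1/2 ≤ ∑ i, (h * (z i : ℝ)) ^ 2 →
      (M / 66 < ∑ j, (1 - Real.cos (sdot (w j) (fun i => h * z i)))) ∧
      ∀ s : Fin M → Bool, ∑ j, sgnB (s j) * sdot (w j) (fun i => h * z i) < 4 * (M:ℝ) := by
  classical
  set S := (netZ n B).filter (fun z => ∑ i, (h * (z i : ℝ)) ^ 2 ≤ 9/4 ∧
    1/2 ≤ ∑ i, (h * (z i : ℝ)) ^ 2) with hS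
  set b1 : (Fin n → ℤ) → Finset (Fin M → Fin n → Bool) := fun z =>
    ((Finset.univ : Finset (Fin M → Fin n → Bool)).filter
      (fun w => ∑ j, (1 - Real.cos (sdot (w j) (fun i => h * (z i : ℝ)))) ≤ M/66)) with hb1
  set b2 : (Fin n → ℤ) → (Fin M → Bool) → Finset (Fin M → Fin n → Bool) := fun z s =>
    ((Finset.univ : Finset (Fin M → Fin n → Bool)).filter
      (fun w => 4 * (M:ℝ) ≤ ∑ j, sgnB (s j) * sdot (w j) (fun i => h * (z i : ℝ)))) with hb2
  set bad := S.biUnion (fun z => b1 z ∪ Finset.univ.biUnion (b2 z)) with hbad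
  have hN : (0:ℝ) < (2^n)^M := by positivity
  have hz : ∀ z ∈ S, ((b1 z ∪ Finset.univ.biUnion (b2 z)).card : ℝ)
      ≤ (2^n)^M * (2 * Real.exp (-(M/66))) := by
    intro z hzS
    rw [hS, Finset.mem_filter] at hzS
    have h1 : ((b1 z).card : ℝ) ≤ _ := bad1 (M := M) (fun i => h * (z i : ℝ)) hzS.2.1 hzS.2.2
    have h2 : ∀ s, ((b2 z s).card : ℝ) ≤ _ := fun s => bad2 s (fun i => h * (z i : ℝ)) hzS.2.1
    have h3 : ((Finset.univ.biUnion (b2 z)).card : ℝ) ≤ 2^M * ((2^n)^M * Real.exp (-(2*M))) := by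
      calc ((Finset.univ.biUnion (b2 z)).card : ℝ) ≤ ∑ s, ((b2 z s).card : ℝ) := by
            exact_mod_cast Finset.card_biUnion_le
        _ ≤ ∑ s : Fin M → Bool, (2^n)^M * Real.exp (-(2*M)) := Finset.sum_le_sum fun s _ => h2 s
        _ = _ := by simp
    have h4 : (2:ℝ)^M ≤ Real.exp M := by
      rw [← mul_one (M:ℝ), Real.exp_nat_mul]
      gcongr
      linarith [Real.exp_one_gt_d9]
    have h5 : (2:ℝ)^M * ((2^n)^M * Real.exp (-(2*M))) ≤ (2^n)^M * Real.exp (-(M/66)) := by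
      calc _ ≤ Real.exp M * ((2^n)^M * Real.exp (-(2*M))) := by gcongr
        _ = (2^n)^M * Real.exp (-M) := by
          rw [mul_left_comm, ← Real.exp_add]; congr 2; ring
        _ ≤ _ := by
          gcongr
          have : (0:ℝ) ≤ M := by positivity
          linarith
    have h6 : ((b1 z ∪ Finset.univ.biUnion (b2 z)).card : ℝ)
        ≤ (b1 z).card + (Finset.univ.biUnion (b2 z)).card := by
      exact_mod_cast Finset.card_union_le _ _
    linarith
  have hc : (bad.card : ℝ) < (2^n)^M := by
    calc (bad.card : ℝ) ≤ ∑ z ∈ S, ((b1 z ∪ Finset.univ.biUnion (b2 z)).card : ℝ) := by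
          exact_mod_cast Finset.card_biUnion_le
      _ ≤ ∑ z ∈ S, (2^n)^M * (2 * Real.exp (-(M/66))) := Finset.sum_le_sum hz
      _ = S.card * ((2^n)^M * (2 * Real.exp (-(M/66)))) := by simp
      _ ≤ Real.exp ((B + 2) * n) * ((2^n)^M * (2 * Real.exp (-(M/66)))) := by
          gcongr
          refine le_trans ?_ (card_netZ n B)
          exact_mod_cast Finset.card_filter_le _ _
      _ = (2^n)^M * (2 * Real.exp ((B + 2) * n + -(M/66))) := by
          rw [Real.exp_add]; ring
      _ ≤ (2^n)^M * (2 * Real.exp (-1)) := by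
          gcongr; linarith
      _ < (2^n)^M * 1 := by
          gcongr
          rw [Real.exp_neg]
          have := Real.exp_one_gt_d9
          rw [← div_eq_mul_inv, div_lt_one (by positivity)]
          linarith
      _ = _ := mul_one _
  have hlt : bad.card < (Finset.univ : Finset (Fin M → Fin n → Bool)).card := by
    rw [Finset.card_univ]
    simp only [Fintype.card_fun, Fintype.card_bool, Fintype.card_fin]
    exact_mod_cast hc
  obtain ⟨w, -, hw⟩ := Finset.exists_mem_notMem_of_card_lt_card hlt
  refine ⟨w, fun z hz1 hz2 hz3 => ?_⟩
  have hzS : z ∈ S := by rw [hS, Finset.mem_filter]; exact ⟨hz1, hz2, hz3⟩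
  have hw' : w ∉ b1 z ∪ Finset.univ.biUnion (b2 z) := fun hh =>
    hw (Finset.mem_biUnion.mpr ⟨z, hzS, hh⟩)
  rw [Finset.mem_union, not_or] at hw'
  refine ⟨?_, fun s => ?_⟩
  · by_contra hh
    exact hw'.1 (by simp only [hb1, Finset.mem_filter, Finset.mem_univ, true_and]; exact not_lt.mp hh)
  · by_contra hh
    refine hw'.2 (Finset.mem_biUnion.mpr ⟨s, Finset.mem_univ _, ?_⟩)
    simp only [hb2, Finset.mem_filter, Finset.mem_univ, true_and]; exact not_lt.mp hh

lemma net_approx {n K : ℕ} (hn : 0 < n) (hK : 4 ≤ K) (x : Fin n → ℝ) (hx : ∑ i, x i ^ 2 = 1)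
    (h : ℝ) (h0 : 0 < h) (hh : h ^ 2 * (K ^ 2 * n) = 1) :
    ∃ z ∈ netZ n (3 * K ^ 2), ∑ i, (h * (z i : ℝ)) ^ 2 ≤ 9/4 ∧ 1/2 ≤ ∑ i, (h * (z i : ℝ)) ^ 2 ∧
      ∑ i, (x i - h * z i) ^ 2 ≤ 1 / (4 * (K:ℝ) ^ 2) := by
  have hK' : (4:ℝ) ≤ K := by exact_mod_cast hK
  have hn' : (0:ℝ) < n := by exact_mod_cast hn
  set z : Fin n → ℤ := fun i => round (x i / h) with hz
  have hd : ∀ i, (x i - h * z i) ^ 2 ≤ h ^ 2 / 4 := by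
    intro i
    have h1 := abs_sub_round (x i / h)
    have h2 : x i - h * z i = h * (x i / h - round (x i / h)) := by
      rw [hz]; field_simp
    rw [h2, mul_pow]
    have h3 : (x i / h - round (x i / h)) ^ 2 ≤ (1/2)^2 := by
      rw [← sq_abs]; gcongr
    nlinarith [sq_nonneg h]
  have hD : ∑ i, (x i - h * z i) ^ 2 ≤ 1 / (4 * (K:ℝ) ^ 2) := by
    calc _ ≤ ∑ i : Fin n, h ^ 2 / 4 := Finset.sum_le_sum fun i _ => hd i
      _ = n * (h ^ 2 / 4) := by simp
      _ = 1 / (4 * (K:ℝ) ^ 2) := by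
        rw [eq_div_iff (by positivity)]; linarith
  have hs : 1 / (4 * (K:ℝ) ^ 2) ≤ 1 / 64 := by
    apply one_div_le_one_div_of_le (by norm_num); nlinarith
  have hu : ∑ i, (h * (z i : ℝ)) ^ 2 ≤ 9/4 := by
    have : ∑ i, (h * (z i : ℝ)) ^ 2 ≤ ∑ i, (5/4 * x i ^ 2 + 5 * (x i - h * z i) ^ 2) := by
      apply Finset.sum_le_sum
      intro i _
      nlinarith [sq_nonneg (x i + 4 * (x i - h * z i))]
    rw [Finset.sum_add_distrib, ← Finset.mul_sum, ← Finset.mul_sum, hx] at this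
    linarith
  have hl : 1/2 ≤ ∑ i, (h * (z i : ℝ)) ^ 2 := by
    have : ∑ i, x i ^ 2 ≤ ∑ i, (5/4 * (h * (z i : ℝ)) ^ 2 + 5 * (x i - h * z i) ^ 2) := by
      apply Finset.sum_le_sum
      intro i _
      nlinarith [sq_nonneg (h * z i - 4 * (x i - h * z i))]
    rw [Finset.sum_add_distrib, ← Finset.mul_sum, ← Finset.mul_sum, hx] at this
    linarith
  refine ⟨z, ?_, hu, hl, hD⟩
  rw [mem_netZ]
  have : ∑ i, (z i : ℝ) ^ 2 ≤ (3 * K ^ 2) * n := by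
    simp_rw [mul_pow, ← Finset.mul_sum] at hu
    calc ∑ i, (z i : ℝ) ^ 2 = (h ^ 2 * ∑ i, (z i : ℝ) ^ 2) * (K ^ 2 * n) := by
          rw [mul_right_comm, hh, one_mul]
      _ ≤ (9/4) * (K ^ 2 * n) := by gcongr
      _ ≤ _ := by nlinarith [mul_pos (pow_pos (by linarith : (0:ℝ) < K) 2) hn']
  exact_mod_cast this

lemma sdot_sub {n : ℕ} (a : Fin n → Bool) (x y : Fin n → ℝ) :
    sdot a (fun i => x i - y i) = sdot a x - sdot a y := by
  simp [sdot, mul_sub, Finset.sum_sub_distrib]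

lemma inner_le_sqrt {n : ℕ} (v d : Fin n → ℝ) (c : ℝ) (hc : 0 ≤ c) (hd : ∑ i, d i ^ 2 ≤ c ^ 2) :
    ∑ i, v i * d i ≤ √(∑ i, v i ^ 2) * c := by
  refine (Real.sum_mul_le_sqrt_mul_sqrt _ v d).trans ?_
  gcongr
  exact Real.sqrt_le_iff.mpr ⟨hc, hd⟩

lemma good_signs {n M : ℕ} (hn : 0 < n)
    (hM : (3 * 1024 ^ 2 + 2) * (n:ℝ) + 1 ≤ M / 66) :
    ∃ w : Fin M → Fin n → Bool, ∀ x : Fin n → ℝ, ∑ i, x i ^ 2 = 1 →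
      (M:ℝ) / 132 ≤ ∑ j, (1 - Real.cos (sdot (w j) x)) := by
  have hn' : (0:ℝ) < n := by exact_mod_cast hn
  set h : ℝ := 1 / (1024 * √n) with hdef
  have h0 : 0 < h := by positivity
  have hh : h ^ 2 * (((1024 : ℕ) : ℝ) ^ 2 * n) = 1 := by
    rw [hdef, div_pow, mul_pow, Real.sq_sqrt hn'.le]; push_cast; field_simp
  obtain ⟨w, hw⟩ := exists_good (n := n) (B := 3 * 1024 ^ 2) (M := M) h (by push_cast; linarith)
  have happ := fun x hx => net_approx (K := 1024) hn (by norm_num) x hx h h0 hh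
  have hM0 : (0:ℝ) ≤ M := by positivity
  refine ⟨w, ?_⟩
  -- norm bound
  have hR : ∀ s : Fin M → Bool, √(∑ i, (∑ j, sgnB (s j) * sgnB (w j i)) ^ 2) ≤ 8 * M := by
    intro s
    set v : Fin n → ℝ := fun i => ∑ j, sgnB (s j) * sgnB (w j i) with hv
    have hvx : ∀ x : Fin n → ℝ, ∑ j, sgnB (s j) * sdot (w j) x = ∑ i, v i * x i := by
      intro x
      simp only [hv, sdot, Finset.mul_sum, Finset.sum_mul]
      rw [Finset.sum_comm]
      simp only [mul_assoc]
    set R := √(∑ i, v i ^ 2) with hRdef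
    have hRR : R ^ 2 = ∑ i, v i ^ 2 := Real.sq_sqrt (Finset.sum_nonneg fun _ _ => sq_nonneg _)
    rcases (Real.sqrt_nonneg (∑ i, v i ^ 2)).eq_or_lt with hz | hp
    · rw [hRdef, ← hz]; positivity
    · rw [← hRdef] at hp
      obtain ⟨z, hz, hz1, hz2, hz3⟩ := happ (fun i => v i / R) (by
        simp_rw [div_pow, ← Finset.sum_div, ← hRR]; field_simp)
      have h1 := (hw z hz hz1 hz2).2 s
      rw [hvx] at h1
      have h2 := inner_le_sqrt v (fun i => v i / R - h * z i) (1/2) (by norm_num)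
        (hz3.trans (by norm_num))
      have h3 : ∑ i, v i * (v i / R - h * z i) = R - ∑ i, v i * (h * z i) := by
        simp_rw [mul_sub, Finset.sum_sub_distrib]
        congr 1
        have : ∀ i, v i * (v i / R) = v i ^ 2 / R := by intro i; ring
        simp_rw [this, ← Finset.sum_div, ← hRR]; field_simp
      rw [h3, ← hRdef] at h2
      show R ≤ _
      linarith
  intro x hx
  obtain ⟨z, hz, hz1, hz2, hz3⟩ := happ x hx
  have h1 := (hw z hz hz1 hz2).1
  set y : Fin n → ℝ := fun i => h * z i with hy
  set d : Fin n → ℝ := fun i => x i - y i with hd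
  have h2 : ∑ j, |sdot (w j) d| ≤ M / 132 := by
    set s : Fin M → Bool := fun j => decide (0 ≤ sdot (w j) d) with hs
    have e1 : ∀ j, |sdot (w j) d| = sgnB (s j) * sdot (w j) d := by
      intro j
      by_cases hj : 0 ≤ sdot (w j) d
      · simp [hs, sgnB, hj]
      · simp [hs, sgnB, hj, abs_of_neg (not_le.mp hj)]
    have e2 : ∑ j, sgnB (s j) * sdot (w j) d = ∑ i, (∑ j, sgnB (s j) * sgnB (w j i)) * d i := by
      simp only [sdot, Finset.mul_sum, Finset.sum_mul]
      rw [Finset.sum_comm]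
      simp only [mul_assoc]
    simp_rw [e1]
    rw [e2]
    have e3 := inner_le_sqrt (fun i => ∑ j, sgnB (s j) * sgnB (w j i)) d (1/2048) (by norm_num)
        (hz3.trans (by norm_num))
    have e4 := hR s
    linarith
  have h3 : ∑ j, (1 - Real.cos (sdot (w j) y)) ≤
      ∑ j, ((1 - Real.cos (sdot (w j) x)) + |sdot (w j) d|) := by
    apply Finset.sum_le_sum
    intro j _
    have e : sdot (w j) d = sdot (w j) x - sdot (w j) y := sdot_sub _ _ _
    rw [e]
    have := Real.abs_cos_sub_cos_le (sdot (w j) x) (sdot (w j) y)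
    have := le_abs_self (Real.cos (sdot (w j) x) - Real.cos (sdot (w j) y))
    linarith
  rw [Finset.sum_add_distrib] at h3
  linarith

lemma pair_bound (a b : ℝ) : (1 - Real.cos (a - b)) / 2 ≤ min (a^2) 1 + min (b^2) 1 := by
  have h1 := Real.neg_one_le_cos (a - b)
  have h2 := Real.one_sub_sq_div_two_le_cos (x := a - b)
  have ha := sq_nonneg a
  have hb := sq_nonneg b
  rcases le_total (a^2) 1 with h | h <;> rcases le_total (b^2) 1 with h' | h' <;>
    simp only [min_eq_left, min_eq_right, h, h'] <;> nlinarith [sq_nonneg (a + b)]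

/-- The 0/1 vectors: each random boolean vector together with its complement. -/
noncomputable def uvec {M n : ℕ} (w : Fin M → Fin n → Bool) (p : Fin M × Bool) (i : Fin n) : ℝ :=
  if w p.1 i = p.2 then 1 else 0

lemma unit_bound {n M : ℕ} (w : Fin M → Fin n → Bool) (x : Fin n → ℝ)
    (hw : (M:ℝ) / 132 ≤ ∑ j, (1 - Real.cos (sdot (w j) x)))
    (J : Finset (Fin M × Bool)) (hJ : (1 - 1/2000) * (2 * (M:ℝ)) ≤ J.card) :
    (M:ℝ) / 500 ≤ ∑ p ∈ J, (∑ i, uvec w p i * x i) ^ 2 := by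
  classical
  set t : Fin M × Bool → ℝ := fun p => ∑ i, uvec w p i * x i with ht
  have h1 : ∑ j, (1 - Real.cos (sdot (w j) x)) / 2 ≤ ∑ p : Fin M × Bool, min (t p ^ 2) 1 := by
    rw [Fintype.sum_prod_type]
    apply Finset.sum_le_sum
    intro j _
    rw [Fintype.sum_bool]
    suffices key : sdot (w j) x = t (j, true) - t (j, false) by
      rw [key]; exact pair_bound _ _
    simp only [ht, sdot]
    rw [← Finset.sum_sub_distrib]
    apply Finset.sum_congr rfl
    intro i _
    cases hji : w j i <;> simp [uvec, sgnB, hji]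
  rw [← Finset.sum_div] at h1
  have h2 : ∑ p : Fin M × Bool, min (t p ^ 2) 1
      = ∑ p ∈ J, min (t p ^ 2) 1 + ∑ p ∈ Jᶜ, min (t p ^ 2) 1 :=
    (Finset.sum_add_sum_compl J _).symm
  have h3 : ∑ p ∈ J, min (t p ^ 2) 1 ≤ ∑ p ∈ J, t p ^ 2 :=
    Finset.sum_le_sum fun _ _ => min_le_left _ _
  have h4 : ∑ p ∈ Jᶜ, min (t p ^ 2) 1 ≤ (Jᶜ.card : ℝ) := by
    calc _ ≤ ∑ p ∈ Jᶜ, (1:ℝ) := Finset.sum_le_sum fun _ _ => min_le_right _ _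
      _ = _ := by simp
  have h5 : (J.card : ℝ) + Jᶜ.card = 2 * M := by
    have := Finset.card_add_card_compl J
    simp only [Fintype.card_prod, Fintype.card_fin, Fintype.card_bool] at this
    rw [mul_comm]; exact_mod_cast this
  have hM0 : (0:ℝ) ≤ M := by positivity
  linarith

lemma all_bound {n M : ℕ} (w : Fin M → Fin n → Bool)
    (hw : ∀ x : Fin n → ℝ, ∑ i, x i ^ 2 = 1 →
      (M:ℝ) / 132 ≤ ∑ j, (1 - Real.cos (sdot (w j) x)))
    (J : Finset (Fin M × Bool)) (hJ : (1 - 1/2000) * (2 * (M:ℝ)) ≤ J.card) (x : Fin n → ℝ) :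
    (M:ℝ) / 500 * ∑ i, x i ^ 2 ≤ ∑ p ∈ J, (∑ i, uvec w p i * x i) ^ 2 := by
  have hnn : 0 ≤ ∑ i, x i ^ 2 := Finset.sum_nonneg fun _ _ => sq_nonneg _
  rcases hnn.eq_or_lt with h | h
  · rw [← h, mul_zero]; exact Finset.sum_nonneg fun _ _ => sq_nonneg _
  · set r := √(∑ i, x i ^ 2) with hr
    have hrr : r ^ 2 = ∑ i, x i ^ 2 := Real.sq_sqrt hnn
    have hrp : 0 < r := Real.sqrt_pos.mpr h
    have h1 : ∑ i, (x i / r) ^ 2 = 1 := by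
      simp_rw [div_pow, ← Finset.sum_div, ← hrr]; field_simp
    have h2 := unit_bound w (fun i => x i / r) (hw _ h1) J hJ
    have h3 : ∀ p, (∑ i, uvec w p i * (x i / r)) ^ 2 = (∑ i, uvec w p i * x i) ^ 2 / r ^ 2 := by
      intro p
      rw [← div_pow, Finset.sum_div]
      simp_rw [mul_div_assoc]
    simp_rw [h3, ← Finset.sum_div] at h2
    rw [le_div_iff₀ (by positivity), hrr] at h2
    exact h2



/-- Spectrum of random outer products: there exist absolute constants `c₀ ∈ ℕ`,
`c₁, c₂ ∈ (0,1)` such that for every `n`, there are binary vectors `u₁, …, u_{m₀} ∈ {0,1}ⁿ`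
with `m₀ = 2^{c₀}·n` such that for every `J ⊆ [m₀]` with `|J| ≥ (1-c₁)·m₀`, the averaged
outer-product matrix `(1/|J|)·∑_{j∈J} uⱼuⱼᵀ` has minimum eigenvalue at least `c₂`,
expressed via its quadratic form. -/
theorem spectrum_of_outer_products :
    ∃ (c₀ : ℕ) (c₁ c₂ : ℝ), c₁ ∈ Set.Ioo (0 : ℝ) 1 ∧ c₂ ∈ Set.Ioo (0 : ℝ) 1 ∧
      ∀ n : ℕ, 0 < n →
        ∃ u : Fin (2 ^ c₀ * n) → (Fin n → ℝ),
          (∀ j i, u j i = 0 ∨ u j i = 1) ∧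
          ∀ J : Finset (Fin (2 ^ c₀ * n)), (1 - c₁) * (2 ^ c₀ * n : ℝ) ≤ (J.card : ℝ) →
            ∀ x : Fin n → ℝ,
              c₂ * ∑ i, (x i) ^ 2
                ≤ x ⬝ᵥ ((J.card : ℝ)⁻¹ • ∑ j ∈ J, vecMulVec (u j) (u j)) *ᵥ x := by

  refine ⟨29, 1/2000, 1/1000, ⟨by norm_num, by norm_num⟩, ⟨by norm_num, by norm_num⟩, ?_⟩
  intro n hn
  have hn' : (1:ℝ) ≤ n := by exact_mod_cast hn
  obtain ⟨w, hw⟩ := good_signs (n := n) (M := 2 ^ 28 * n) hn (by push_cast; linarith)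
  have hcard : Fintype.card (Fin (2 ^ 29 * n)) = Fintype.card (Fin (2 ^ 28 * n) × Bool) := by
    simp only [Fintype.card_prod, Fintype.card_fin, Fintype.card_bool]; ring
  let e := Fintype.equivOfCardEq hcard
  refine ⟨fun k => uvec w (e k), ?_, ?_⟩
  · intro j i
    show uvec w (e j) i = 0 ∨ uvec w (e j) i = 1
    unfold uvec
    split_ifs <;> simp
  · intro J hJ x
    have h1 := all_bound w hw (J.map e.toEmbedding) (by
      rw [Finset.card_map]; refine le_trans (le_of_eq ?_) hJ; push_cast; ring) x
    rw [Finset.sum_map] at h1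
    have h2 : x ⬝ᵥ ((J.card : ℝ)⁻¹ • ∑ j ∈ J, vecMulVec (uvec w (e j)) (uvec w (e j))) *ᵥ x
        = (J.card : ℝ)⁻¹ * ∑ j ∈ J, (∑ i, uvec w (e j) i * x i) ^ 2 := by
      rw [Matrix.smul_mulVec, dotProduct_smul, smul_eq_mul, Matrix.sum_mulVec, dotProduct_sum]
      congr 1
      apply Finset.sum_congr rfl
      intro j _
      rw [Matrix.vecMulVec_mulVec, dotProduct_smul]
      simp [dotProduct, sq, mul_comm]
    rw [h2]
    have hJpos : (0:ℝ) < J.card := lt_of_lt_of_le (by norm_num; linarith) hJ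
    have hJle : (J.card : ℝ) ≤ 2 ^ 29 * n := by
      have := Finset.card_le_univ J
      rw [Fintype.card_fin] at this
      exact_mod_cast this
    rw [← div_eq_inv_mul, le_div_iff₀ hJpos]
    refine le_trans ?_ h1
    have hnn : 0 ≤ ∑ i, x i ^ 2 := Finset.sum_nonneg fun _ _ => sq_nonneg _
    rw [mul_right_comm]
    gcongr
    push_cast
    linarith
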